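/- arXiv:1902.05765 — 2 statements merged into one kernel-verified Lean document; each statement's English description precedes it below -/
import Mathlib

section
/- Let D̃_{in,l} be a perturbation over R̃_l of an initial scattering diagram and let Γ be a weighted k-tree, with associated element n_Γ ∈ N̄ and locus of stops P_Γ = ev(closure of 𝔐_Γ(M_ℝ, D̃_{in,l})) ⊆ M_ℝ. If P_Γ is non-empty, then P_Γ is orthogonal to n_Γ, i.e. the linear functional n_Γ vanishes on the difference of any two points of P_Γ. -/
/-!
STATEMENT 1.  Let `D̃_{in,l}` be a perturbation (over `R̃_l`) of an initial
scattering diagram, and let `Γ` be a weighted `k`-tree with associated element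
`n_Γ ∈ N̄` and locus of stops `P_Γ = ev(closure 𝔐_Γ(M_ℝ, D̃_{in,l})) ⊆ M_ℝ`.
If `P_Γ` is non-empty, then `P_Γ` is orthogonal to `n_Γ`: the linear functional
`n_Γ` vanishes on the difference of any two points of `P_Γ`.

We take `M = Fin r → ℤ`, `M_ℝ = Fin r → ℝ`, `N = Fin r → ℤ` with the standard
pairing.  A wall `w_{iJ} = (m_i, n_i, P_{iJ}, Θ_{iJ})` of the perturbed diagram
is recorded below by its primitive direction `mdir = m_i`, its multiplicity
`mult = #J` (so the weight of an incoming edge is `m_e = (#J) m_i`), the normal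
vector `nvec = n_i` (with `⟨m_i, n_i⟩ = 0`), and the affine translate constant
`c` (so the support is `{x | ⟨x, n_i⟩ = c}`, a translate of `n_i^⊥`).
Weighted `k`-trees are represented as binary trees whose `k` leaves are
labeled by walls; the data `(m_e, n_e)` propagates along the tree by
`m_{e₃} = m_{e₁} + m_{e₂}` and
`n_{e₃} = ⟨m_{e₂},n_{e₁}⟩ n_{e₂} - ⟨m_{e₁},n_{e₂}⟩ n_{e₁}`, and the locus of
stops is obtained by starting on the walls and flowing along `-m_e` on each
edge (edge lengths `≤ 0`, i.e. the closure of the moduli space of tropical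
disks of type `Γ`, pushed forward by the evaluation at the stop).
-/

namespace Scattering1

def dotR {r : ℕ} (x y : Fin r → ℝ) : ℝ := ∑ i, x i * y i

def toR {r : ℕ} (m : Fin r → ℤ) : Fin r → ℝ := fun i => (m i : ℝ)

def pairZ {r : ℕ} (m n : Fin r → ℤ) : ℤ := ∑ i, m i * n i

/-- A wall of the perturbed initial scattering diagram `D̃_{in,l}`. -/
structure Wall (r : ℕ) where
  mdir : Fin r → ℤ        -- primitive direction m_i ∈ M_σ^+
  mult : ℕ                -- #J_e, so that the edge weight is m_e = (#J_e)·m_i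
  nvec : Fin r → ℤ        -- n_i ∈ N̄ \ {0}
  c : ℝ                   -- support is the translate {x | ⟨x, n_i⟩ = c} of n_i^⊥
  mult_pos : 0 < mult
  mdir_ne : mdir ≠ 0
  nvec_ne : nvec ≠ 0
  orth : pairZ mdir nvec = 0

def Wall.mweight {r : ℕ} (w : Wall r) : Fin r → ℤ := (w.mult : ℤ) • w.mdir

def Wall.support {r : ℕ} (w : Wall r) : Set (Fin r → ℝ) :=
  {x | dotR x (toR w.nvec) = w.c}

/-- Weighted `k`-trees (trivalent, directed, with `k` incoming edges labeled by
walls of the perturbed diagram). -/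
inductive Tree (ι : Type) where
  | leaf : ι → Tree ι
  | node : Tree ι → Tree ι → Tree ι

namespace Tree

variable {r : ℕ} {ι : Type}

/-- the element `m_e ∈ M_σ^+` attached to the outgoing edge -/
def mOf (w : ι → Wall r) : Tree ι → Fin r → ℤ
  | .leaf i => (w i).mweight
  | .node t₁ t₂ => mOf w t₁ + mOf w t₂

/-- the element `n_Γ ∈ N̄` attached to the outgoing edge (defined up to sign) -/
def nOf (w : ι → Wall r) : Tree ι → Fin r → ℤ
  | .leaf i => (w i).nvec
  | .node t₁ t₂ =>
      pairZ (mOf w t₂) (nOf w t₁) • nOf w t₂ - pairZ (mOf w t₁) (nOf w t₂) • nOf w t₁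

/-- `P_Γ = ev(closure 𝔐_Γ(M_ℝ, D̃_{in,l}))`: the locus of stops of tropical
disks of type `Γ` in `(M_ℝ, D̃_{in,l})` (unbounded ends on the walls, each
edge a segment of direction `-m_e`, evaluated at the stop). -/
def stops (w : ι → Wall r) : Tree ι → Set (Fin r → ℝ)
  | .leaf i => (w i).support
  | .node t₁ t₂ => {x | ∃ y, (y ∈ stops w t₁ ∧ y ∈ stops w t₂) ∧
      ∃ t : ℝ, 0 ≤ t ∧ x = y - t • toR (mOf w t₁ + mOf w t₂)}

end Tree

theorem dotR_toR {r : ℕ} (m n : Fin r → ℤ) : dotR (toR m) (toR n) = (pairZ m n : ℝ) := by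
  simp [dotR, toR, pairZ]

theorem dotR_comb {r : ℕ} (x : Fin r → ℝ) (a b : ℤ) (n₁ n₂ : Fin r → ℤ) :
    dotR x (toR (a • n₂ - b • n₁)) = a * dotR x (toR n₂) - b * dotR x (toR n₁) := by
  simp only [dotR, toR, Finset.mul_sum, ← Finset.sum_sub_distrib]
  refine Finset.sum_congr rfl fun i _ => ?_
  simp only [Pi.sub_apply, Pi.smul_apply, smul_eq_mul]
  push_cast
  ring

theorem dotR_left {r : ℕ} (x y m n : Fin r → ℝ) (s t : ℝ) :
    dotR ((x - s • m) - (y - t • m)) n = dotR (x - y) n - (s - t) * dotR m n := by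
  simp only [dotR, Finset.mul_sum, ← Finset.sum_sub_distrib]
  refine Finset.sum_congr rfl fun i _ => ?_
  simp only [Pi.sub_apply, Pi.smul_apply, smul_eq_mul]
  ring

theorem pairZ_orth {r : ℕ} (m₁ m₂ n₁ n₂ : Fin r → ℤ) (a b : ℤ) :
    pairZ (m₁ + m₂) (a • n₂ - b • n₁) =
      a * pairZ m₁ n₂ + a * pairZ m₂ n₂ - b * pairZ m₁ n₁ - b * pairZ m₂ n₁ := by
  simp only [pairZ, Finset.mul_sum, ← Finset.sum_sub_distrib, ← Finset.sum_add_distrib]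
  refine Finset.sum_congr rfl fun i _ => ?_
  simp only [Pi.sub_apply, Pi.add_apply, Pi.smul_apply, smul_eq_mul]
  ring

theorem pairZ_mOf_nOf {r : ℕ} {ι : Type} (w : ι → Wall r) (Γ : Tree ι) :
    pairZ (Γ.mOf w) (Γ.nOf w) = 0 := by
  induction Γ with
  | leaf i =>
    have h := (w i).orth
    simp only [pairZ] at h
    simp [Tree.mOf, Tree.nOf, Wall.mweight, pairZ, mul_assoc, ← Finset.mul_sum, h]
  | node t₁ t₂ h₁ h₂ =>
    simp only [Tree.mOf, Tree.nOf]
    rw [pairZ_orth, h₁, h₂]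
    ring

theorem stops_orth {r : ℕ} {ι : Type} (w : ι → Wall r) (Γ : Tree ι) :
    ∀ x ∈ Γ.stops w, ∀ y ∈ Γ.stops w, dotR (x - y) (toR (Γ.nOf w)) = 0 := by
  induction Γ with
  | leaf i =>
    intro x hx y hy
    simp only [Tree.stops, Wall.support, Set.mem_setOf_eq, dotR] at hx hy
    simp [Tree.nOf, dotR, sub_mul, hx, hy]
  | node t₁ t₂ h₁ h₂ =>
    rintro x ⟨x', ⟨hx₁, hx₂⟩, s, -, rfl⟩ y ⟨y', ⟨hy₁, hy₂⟩, t, -, rfl⟩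
    have h := pairZ_mOf_nOf w (.node t₁ t₂)
    rw [dotR_left, dotR_toR]
    simp only [Tree.mOf] at h
    rw [h]
    simp only [Tree.nOf]
    rw [dotR_comb, h₁ _ hx₁ _ hy₁, h₂ _ hx₂ _ hy₂]
    simp

/-- Lemma `normal_lemma`: if the locus of stops `P_Γ` of a
weighted tree `Γ` is non-empty, then it is orthogonal to `n_Γ`. -/
theorem stmt1 (r : ℕ) (ι : Type) (w : ι → Wall r) (Γ : Tree ι)
    (hne : (Γ.stops w).Nonempty) :
    ∀ x ∈ Γ.stops w, ∀ y ∈ Γ.stops w, dotR (x - y) (toR (Γ.nOf w)) = 0 := by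
  exact stops_orth w Γ

end Scattering1
end

section
/- Let P ⊂ M_ℝ be an affine hyperplane defined as the zero set of an affine function η = ⟨·,n⟩ + c with n ∈ N primitive, and set δ_P = (πℏ)^{−1/2} e^{−η²/ℏ} dη, an ℏ-dependent 1-form on M_ℝ. Then δ_P has asymptotic support on P with weight 1, i.e. δ_P ∈ W^1_P(M_ℝ). -/
open MeasureTheory

namespace ScatteringLib

def dotR {r : ℕ} (x y : Fin r → ℝ) : ℝ := ∑ i, x i * y i

def toR {r : ℕ} (m : Fin r → ℤ) : Fin r → ℝ := fun i => (m i : ℝ)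

/-- `ℏ`-dependent `k`-forms on `M_ℝ = Fin r → ℝ`, recorded by their coefficient
functions `ω_{i₁ ⋯ i_k}`. -/
abbrev HForm (r k : ℕ) := ℝ → (Fin r → ℝ) → (Fin k → Fin r) → ℝ

/-- contraction of a `k`-form with `k` vectors -/
def contr {r k : ℕ} (ω : (Fin k → Fin r) → ℝ) (v : Fin k → Fin r → ℝ) : ℝ :=
  ∑ idx : Fin k → Fin r, ω idx * ∏ l, v l (idx l)

/-- `W^{-∞}` near a point: all derivatives exponentially small as `ℏ → 0` on a
neighborhood. -/
def ExpSmallNear {E : Type} [NormedAddCommGroup E] [NormedSpace ℝ E] {r : ℕ}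
    (α : ℝ → (Fin r → ℝ) → E) (q : Fin r → ℝ) : Prop :=
  ∃ V ∈ nhds q, ∃ c : ℝ, 0 < c ∧ ∀ j : ℕ, ∃ D : ℝ,
    ∀ ℏ ∈ Set.Ioc (0:ℝ) 1, ∀ x ∈ V,
      ‖iteratedFDeriv ℝ j (α ℏ) x‖ ≤ D * Real.exp (-c / ℏ)

/-- a closed tropical polyhedral subset: cut out by finitely many rational
affine inequalities -/
def IsTropPoly {r : ℕ} (P : Set (Fin r → ℝ)) : Prop :=
  ∃ S : Finset ((Fin r → ℚ) × ℚ),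
    P = ⋂ p ∈ S, {x | (∑ i, x i * ((p.1 i : ℝ))) ≤ (p.2 : ℝ)}

/-- the affine data of the codimension-`k` affine subspace containing a
codimension-`k` tropical polyhedral subset: normal covectors `n_i`,
constants, and a dual frame. -/
structure NormalData (r k : ℕ) where
  nrml : Fin k → Fin r → ℝ
  cst : Fin k → ℝ
  dual : Fin k → Fin r → ℝ
  dual_pair : ∀ i j, dotR (dual i) (nrml j) = if i = j then 1 else 0

/-- affine coordinates transverse to `P`, parametrizing the foliation by
parallel leaves (`x' = 0` on the leaf containing `P`). -/
def NormalData.leafCoord {r k : ℕ} (nd : NormalData r k) (x : Fin r → ℝ) : Fin k → ℝ :=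
  fun i => dotR x (nd.nrml i) - nd.cst i

/-- the components of the constant `k`-form `ν_P = n₁ ∧ ⋯ ∧ n_k` normal to `P` -/
noncomputable def NormalData.nu {r k : ℕ} (nd : NormalData r k) : (Fin k → Fin r) → ℝ :=
  fun idx => Matrix.det (Matrix.of fun l l' => nd.nrml l' (idx l))

/-- `α ∈ W^s_P(M_ℝ)`: `α` has asymptotic support on the closed codimension-`k`
tropical polyhedral subset `P` with weight `s`. -/
def HasAsymSupport {r k : ℕ} (α : HForm r k) (P : Set (Fin r → ℝ))
    (nd : NormalData r k) (s : ℤ) : Prop :=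
  IsTropPoly P ∧
  (∀ x ∈ P, nd.leafCoord x = 0) ∧
  -- (1) exponentially small away from P
  (∀ q, q ∉ P → ExpSmallNear α q) ∧
  -- (2) on a neighborhood of P, α = h(x,ℏ) ν_P + (exponentially small)
  (∃ W : Set (Fin r → ℝ), IsOpen W ∧ P ⊆ W ∧
    ∃ h : ℝ → (Fin r → ℝ) → ℝ,
      (∀ ℏ ∈ Set.Ioc (0:ℝ) 1, ContDiff ℝ (⊤ : ℕ∞) (h ℏ)) ∧
      ∀ q ∈ W, ExpSmallNear (fun ℏ x => (α ℏ x) - (fun idx => h ℏ x * nd.nu idx)) q) ∧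
  -- (3) weighted transverse integral estimates controlling the ℏ-order
  (∀ (j : ℕ) (β : Fin k → ℕ), ∃ D : ℝ, ∀ ℏ ∈ Set.Ioc (0:ℝ) 1,
    ∃ g : (Fin k → ℝ) → ℝ,
      (∀ x, ‖iteratedFDeriv ℝ j (fun y => contr (α ℏ y) nd.dual) x‖ ≤
        g (nd.leafCoord x)) ∧
      Integrable (fun t : Fin k → ℝ => (∏ i, |t i| ^ (β i)) * g t) ∧
      (∫ t : Fin k → ℝ, (∏ i, |t i| ^ (β i)) * g t) ≤
        D * ℏ ^ (-(((j : ℝ) + (s : ℝ) - (∑ i, (β i : ℝ)) - (k : ℝ)) / 2)))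

/-- `α ∈ W̃^s_k(M_ℝ)`: a finite sum of forms with asymptotic support of
weight `s` on codimension-`k` tropical polyhedral subsets. -/
def InWtilde {r k : ℕ} (α : HForm r k) (s : ℤ) : Prop :=
  ∃ (n : ℕ) (αs : Fin n → HForm r k) (Ps : Fin n → Set (Fin r → ℝ))
    (nds : Fin n → NormalData r k),
    (∀ ℏ x idx, α ℏ x idx = ∑ a, αs a ℏ x idx) ∧
    ∀ a, HasAsymSupport (αs a) (Ps a) (nds a) s

/-- the exterior derivative (componentwise) -/
noncomputable def extD {r k : ℕ} (ω : HForm r k) : HForm r (k+1) :=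
  fun ℏ x idx => ∑ l : Fin (k+1),
    (-1 : ℝ) ^ (l : ℕ) *
      fderiv ℝ (fun y => ω ℏ y (fun m => idx (l.succAbove m))) x (Pi.single (idx l) 1)

/-- `α ∈ W^s_k(M_ℝ)`: `α ∈ W̃^s_k` and `dα ∈ W̃^{s+1}_{k+1}`. -/
noncomputable def InW {r k : ℕ} (α : HForm r k) (s : ℤ) : Prop :=
  InWtilde α s ∧ InWtilde (extD α) (s+1)

end ScatteringLib

/-!
STATEMENT 2.  Let `P ⊂ M_ℝ` be the affine hyperplane cut out by the affine
function `η = ⟨·, n⟩ + c` with `n ∈ N` primitive, and let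
`δ_P = (πℏ)^{-1/2} e^{-η²/ℏ} dη` be the associated `ℏ`-dependent 1-form.
Then `δ_P` has asymptotic support on `P` with weight `1`, i.e.
`δ_P ∈ W^1_P(M_ℝ)`.
-/

open ScatteringLib

/-- the affine function `η = ⟨·, n⟩ + c` -/
def etaFun {r : ℕ} (n : Fin r → ℤ) (c : ℚ) (x : Fin r → ℝ) : ℝ :=
  dotR x (toR n) + (c : ℝ)

/-- the Gaussian one-form `δ_P = (πℏ)^{-1/2} e^{-η²/ℏ} dη` -/
noncomputable def deltaP {r : ℕ} (n : Fin r → ℤ) (c : ℚ) : HForm r 1 :=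
  fun ℏ x idx =>
    (Real.pi * ℏ) ^ (-(1:ℝ)/2) * Real.exp (-(etaFun n c x)^2 / ℏ) * (toR n (idx 0))

lemma gauss_iter (j : ℕ) : ∃ p : Polynomial ℝ, ∀ u : ℝ,
    iteratedDeriv j (fun u : ℝ => Real.exp (-u^2)) u = p.eval u * Real.exp (-u^2) := by
  induction j with
  | zero => exact ⟨1, fun u => by simp⟩
  | succ j ih =>
    obtain ⟨p, hp⟩ := ih
    refine ⟨Polynomial.derivative p - 2 * Polynomial.X * p, fun u => ?_⟩
    rw [iteratedDeriv_succ]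
    have : iteratedDeriv j (fun u : ℝ => Real.exp (-u^2)) =
        fun u => p.eval u * Real.exp (-u^2) := funext hp
    rw [this]
    have h1 : HasDerivAt (fun u : ℝ => -u^2) (-(2*u)) u := by
      have := (hasDerivAt_pow 2 u).fun_neg
      simpa using this
    rw [((p.hasDerivAt u).fun_mul h1.exp).deriv]
    simp
    ring

lemma pow_exp_bdd (m : ℕ) : ∃ C : ℝ, 0 ≤ C ∧ ∀ u : ℝ, |u|^m * Real.exp (-u^2) ≤ C * Real.exp (-u^2/2) := by
  refine ⟨(m.factorial : ℝ) * Real.exp (1/2), by positivity, fun u => ?_⟩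
  have h := Real.pow_div_factorial_le_exp |u| (abs_nonneg u) m
  have hf : (0:ℝ) < m.factorial := by positivity
  rw [div_le_iff₀ hf] at h
  calc |u|^m * Real.exp (-u^2) ≤ (Real.exp |u| * m.factorial) * Real.exp (-u^2) := by gcongr
    _ = m.factorial * Real.exp (|u| + -u^2) := by rw [Real.exp_add]; ring
    _ ≤ m.factorial * Real.exp (1/2 + -u^2/2) := by
        have : |u| + -u^2 ≤ 1/2 + -u^2/2 := by nlinarith [sq_abs u, sq_nonneg (|u|-1)]
        gcongr ?_ * ?_
        exact Real.exp_le_exp.2 this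
    _ = _ := by rw [Real.exp_add]; ring

lemma poly_exp_bdd (p : Polynomial ℝ) : ∃ C : ℝ, 0 ≤ C ∧
    ∀ u : ℝ, |p.eval u| * Real.exp (-u^2) ≤ C * Real.exp (-u^2/2) := by
  induction p using Polynomial.induction_on' with
  | add p q hp hq =>
    obtain ⟨C, hC, h⟩ := hp
    obtain ⟨D, hD, h'⟩ := hq
    refine ⟨C + D, by positivity, fun u => ?_⟩
    have := abs_add_le (p.eval u) (q.eval u)
    have := mul_le_mul_of_nonneg_right this (Real.exp_pos (-u^2)).le
    rw [Polynomial.eval_add]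
    linarith [h u, h' u]
  | monomial m a =>
    obtain ⟨C, hC, h⟩ := pow_exp_bdd m
    refine ⟨|a| * C, by positivity, fun u => ?_⟩
    rw [Polynomial.eval_monomial, abs_mul, abs_pow]
    have := mul_le_mul_of_nonneg_left (h u) (abs_nonneg a)
    linarith

lemma gauss_bdd (j : ℕ) : ∃ C : ℝ, 0 ≤ C ∧ ∀ u : ℝ,
    ‖iteratedFDeriv ℝ j (fun u : ℝ => Real.exp (-u^2)) u‖ ≤ C * Real.exp (-u^2/2) := by
  obtain ⟨p, hp⟩ := gauss_iter j
  obtain ⟨C, hC, h⟩ := poly_exp_bdd p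
  refine ⟨C, hC, fun u => ?_⟩
  rw [norm_iteratedFDeriv_eq_norm_iteratedDeriv, hp, norm_mul, Real.norm_eq_abs, Real.norm_eq_abs,
    Real.abs_exp]
  exact h u

noncomputable def dotCLM {r : ℕ} (y : Fin r → ℝ) : (Fin r → ℝ) →L[ℝ] ℝ :=
  ∑ i, y i • ContinuousLinearMap.proj (R := ℝ) (φ := fun _ : Fin r => ℝ) i

lemma dotCLM_apply {r : ℕ} (y x : Fin r → ℝ) : dotCLM y x = dotR x y := by
  simp [dotCLM, dotR, mul_comm]

lemma gauss_form_bdd {E : Type} [NormedAddCommGroup E] [NormedSpace ℝ E] {r : ℕ}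
    (n : Fin r → ℤ) (c : ℚ) (w : E) (j : ℕ) : ∃ C : ℝ, 0 ≤ C ∧
    ∀ ℏ : ℝ, 0 < ℏ → ∀ x : Fin r → ℝ,
    ‖iteratedFDeriv ℝ j (fun x => ((Real.pi * ℏ) ^ (-(1:ℝ)/2) *
      Real.exp (-(etaFun n c x)^2 / ℏ)) • w) x‖ ≤
      C * (ℏ ^ (-((j:ℝ)+1)/2) * Real.exp (-(etaFun n c x)^2 / (2*ℏ))) := by
  obtain ⟨C, hC, h⟩ := gauss_bdd j
  set L := dotCLM (toR n) with hL
  refine ⟨Real.pi ^ (-(1:ℝ)/2) * ‖w‖ * C * ‖L‖^j, by positivity, fun ℏ hh x => ?_⟩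
  set s : ℝ := Real.sqrt ℏ with hs
  have hspos : 0 < s := Real.sqrt_pos.2 hh
  have hss : s^2 = ℏ := Real.sq_sqrt hh.le
  set G : ℝ → ℝ := fun u => Real.exp (-u^2) with hG
  have hGs : ContDiff ℝ (⊤ : ℕ∞) G := by fun_prop
  set T : ℝ →L[ℝ] E := (Real.pi * ℏ) ^ (-(1:ℝ)/2) • ContinuousLinearMap.toSpanSingleton ℝ w with hT
  set b : ℝ := s⁻¹ * c
  set A : (Fin r → ℝ) →L[ℝ] ℝ := s⁻¹ • L
  have hAx : ∀ x, A x + b = s⁻¹ * etaFun n c x := by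
    intro x
    simp [A, b, hL, dotCLM_apply, etaFun]; ring
  have hfun : (fun x => ((Real.pi * ℏ) ^ (-(1:ℝ)/2) *
      Real.exp (-(etaFun n c x)^2 / ℏ)) • w) = T ∘ ((fun u => G (u + b)) ∘ A) := by
    funext x
    simp only [Function.comp, hAx, hG, hT, ContinuousLinearMap.smul_apply,
      ContinuousLinearMap.toSpanSingleton_apply, smul_smul]
    congr 3
    rw [mul_pow, inv_pow, hss]; field_simp
  have hGb : ContDiff ℝ (⊤ : ℕ∞) (fun u => G (u + b)) := by fun_prop
  have hTn : ‖T‖ ≤ (Real.pi * ℏ) ^ (-(1:ℝ)/2) * ‖w‖ := by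
    rw [hT, norm_smul, ContinuousLinearMap.norm_toSpanSingleton, Real.norm_of_nonneg (by positivity)]
  have hAn : ‖A‖ = s⁻¹ * ‖L‖ := by
    simp only [A]; rw [norm_smul, Real.norm_of_nonneg (by positivity)]
  rw [hfun]
  have h1 : ‖iteratedFDeriv ℝ j (T ∘ ((fun u => G (u + b)) ∘ A)) x‖ ≤
      ‖T‖ * ‖iteratedFDeriv ℝ j ((fun u => G (u + b)) ∘ A) x‖ :=
    ContinuousLinearMap.norm_iteratedFDeriv_comp_left T
      ((hGb.comp A.contDiff).contDiffAt) (by exact_mod_cast le_top)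
  have h2 : ‖iteratedFDeriv ℝ j ((fun u => G (u + b)) ∘ A) x‖ ≤
      C * Real.exp (-(etaFun n c x)^2 / (2*ℏ)) * ‖A‖^j := by
    rw [A.iteratedFDeriv_comp_right hGb x (i := j) (by exact_mod_cast le_top)]
    refine (ContinuousMultilinearMap.norm_compContinuousLinearMap_le _ _).trans ?_
    rw [iteratedFDeriv_comp_add_right]
    simp only [Finset.prod_const, Finset.card_univ, Fintype.card_fin]
    gcongr
    refine (h _).trans (le_of_eq ?_)
    rw [hAx, mul_pow, inv_pow, hss]
    congr 2
    field_simp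
  have hpow : ℏ ^ (-(1:ℝ)/2) * (s⁻¹)^j = ℏ ^ (-((j:ℝ)+1)/2) := by
    rw [hs, Real.sqrt_eq_rpow, ← Real.rpow_neg hh.le, ← Real.rpow_natCast, ← Real.rpow_mul hh.le,
      ← Real.rpow_add hh]
    congr 1; ring
  calc _ ≤ _ := h1
    _ ≤ ((Real.pi * ℏ) ^ (-(1:ℝ)/2) * ‖w‖) *
        (C * Real.exp (-(etaFun n c x)^2 / (2*ℏ)) * ‖A‖^j) := by gcongr
    _ = _ := by
      rw [hAn, ← hpow, Real.mul_rpow Real.pi_pos.le hh.le, mul_pow]; ring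

lemma rpow_exp_bdd (j : ℕ) (a : ℝ) (ha : 0 < a) : ∃ K : ℝ, 0 ≤ K ∧ ∀ ℏ ∈ Set.Ioc (0:ℝ) 1,
    ℏ ^ (-((j:ℝ)+1)/2) ≤ K * Real.exp (a / ℏ) := by
  refine ⟨((j+1).factorial : ℝ) / a^(j+1), by positivity, fun ℏ hh => ?_⟩
  obtain ⟨h0, h1⟩ := hh
  have h := Real.pow_div_factorial_le_exp (a/ℏ) (by positivity) (j+1)
  have hle : ℏ ^ (-((j:ℝ)+1)/2) ≤ ℏ ^ (-((j+1 : ℕ):ℝ)) := by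
    apply Real.rpow_le_rpow_of_exponent_ge h0 h1
    push_cast; linarith [(Nat.cast_nonneg j : (0:ℝ) ≤ j)]
  refine hle.trans ?_
  rw [Real.rpow_neg h0.le, Real.rpow_natCast]
  calc (ℏ^(j+1))⁻¹ = ((j+1).factorial : ℝ) / a^(j+1) * ((a/ℏ)^(j+1) / (j+1).factorial) := by
        rw [div_pow]; field_simp
    _ ≤ _ := by gcongr

lemma int_base (m : ℕ) {b : ℝ} (hb : 0 < b) :
    Integrable (fun u : ℝ => |u|^m * Real.exp (-b * u^2)) := by
  have := (integrable_rpow_mul_exp_neg_mul_sq hb (s := (m:ℝ))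
    (by linarith [(Nat.cast_nonneg m : (0:ℝ) ≤ m)])).norm
  simpa [Real.rpow_natCast, abs_mul, Real.abs_exp] using this

lemma int_scale (m : ℕ) {ℏ : ℝ} (hh : 0 < ℏ) :
    ∫ u : ℝ, |u|^m * Real.exp (-u^2/(2*ℏ)) =
      ℏ ^ (((m:ℝ)+1)/2) * ∫ u : ℝ, |u|^m * Real.exp (-(1/2) * u^2) := by
  set s : ℝ := Real.sqrt ℏ with hs
  have hspos : 0 < s := Real.sqrt_pos.2 hh
  have hss : s^2 = ℏ := Real.sq_sqrt hh.le
  have h := Measure.integral_comp_mul_left (fun u : ℝ => |u|^m * Real.exp (-u^2/(2*ℏ))) s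
  have h2 : ∀ u : ℝ, |s*u|^m * Real.exp (-(s*u)^2/(2*ℏ)) =
      s^m * (|u|^m * Real.exp (-(1/2) * u^2)) := by
    intro u
    rw [abs_mul, abs_of_pos hspos, mul_pow, mul_pow, hss]
    have : -(ℏ * u^2)/(2*ℏ) = -(1/2)*u^2 := by field_simp
    rw [this]; ring
  simp only [h2] at h
  rw [integral_const_mul, abs_of_pos (by positivity), smul_eq_mul] at h
  have h3 : ℏ ^ (((m:ℝ)+1)/2) = s * s^m := by
    rw [← pow_succ', hs, Real.sqrt_eq_rpow, ← Real.rpow_natCast, ← Real.rpow_mul hh.le]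
    congr 1; push_cast; ring
  rw [h3, mul_assoc, h]
  field_simp

theorem stmt2 (r : ℕ) (n : Fin r → ℤ)
    (hn : n ≠ 0)
    (hprim : Finset.univ.gcd n = 1)      -- n is primitive
    (c : ℚ)
    -- any choice of transverse affine data for the hyperplane P = {η = 0},
    -- with normal covector dη = n
    (nd : NormalData r 1)
    (hnrml : nd.nrml 0 = toR n) (hcst : nd.cst 0 = -(c : ℝ)) :
    HasAsymSupport (deltaP n c) {x | etaFun n c x = 0} nd 1 := by
  have hleaf : ∀ x, nd.leafCoord x = fun _ => etaFun n c x := by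
    intro x
    funext i
    rw [Subsingleton.elim i 0]
    simp [NormalData.leafCoord, hnrml, hcst, etaFun]
  have hdelta : ∀ ℏ, deltaP n c ℏ = fun x => ((Real.pi * ℏ) ^ (-(1:ℝ)/2) *
      Real.exp (-(etaFun n c x)^2 / ℏ)) • (fun idx : Fin 1 → Fin r => toR n (idx 0)) := by
    intro ℏ; funext x idx; simp [deltaP]
  have hcont : Continuous (etaFun n c) := by
    unfold etaFun dotR; fun_prop
  refine ⟨?_, ?_, ?_, ?_, ?_⟩
  · refine ⟨{(fun i => (n i : ℚ), -c), (fun i => -(n i : ℚ), c)}, ?_⟩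
    ext x
    simp only [Set.mem_setOf_eq, Finset.mem_insert, Finset.mem_singleton, Set.iInter_iInter_eq_or_left,
      Set.iInter_iInter_eq_left, Set.mem_inter_iff, etaFun, dotR, toR]
    push_cast
    simp only [mul_neg, Finset.sum_neg_distrib]
    constructor
    · intro h; constructor <;> linarith
    · rintro ⟨h1, h2⟩; linarith
  · intro x hx
    rw [hleaf]; funext i; exact hx
  · intro q hq
    have hq' : etaFun n c q ≠ 0 := hq
    set e := (etaFun n c q)^2 with he
    have hepos : 0 < e := by positivity
    refine ⟨{x | e/2 < (etaFun n c x)^2}, ?_, e/8, by positivity, fun j => ?_⟩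
    · exact (isOpen_lt continuous_const (hcont.pow 2)).mem_nhds (by
        show e/2 < (etaFun n c q)^2
        rw [← he]; linarith)
    · obtain ⟨C, hC, h⟩ := gauss_form_bdd n c (fun idx : Fin 1 → Fin r => toR n (idx 0)) j
      obtain ⟨K, hK, hk⟩ := rpow_exp_bdd j (e/8) (by positivity)
      refine ⟨C * K, fun ℏ hh x hx => ?_⟩
      have h0 := hh.1
      rw [hdelta]
      refine (h ℏ h0 x).trans ?_
      have hx' : e/2 < (etaFun n c x)^2 := hx
      calc C * (ℏ ^ (-((j:ℝ)+1)/2) * Real.exp (-(etaFun n c x)^2 / (2*ℏ)))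
          ≤ C * ((K * Real.exp (e/8/ℏ)) * Real.exp (-(e/2) / (2*ℏ))) := by
            gcongr
            exact hk ℏ hh
        _ = C * K * (Real.exp (e/8/ℏ) * Real.exp (-(e/2) / (2*ℏ))) := by ring
        _ = _ := by
            rw [← Real.exp_add]; congr 2; field_simp; ring
  · refine ⟨Set.univ, isOpen_univ, Set.subset_univ _, fun ℏ x => (Real.pi * ℏ) ^ (-(1:ℝ)/2) *
      Real.exp (-(etaFun n c x)^2 / ℏ), ?_, ?_⟩
    · intro ℏ _
      unfold etaFun dotR
      fun_prop
    · intro q _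
      have : (fun (ℏ : ℝ) (x : Fin r → ℝ) => (deltaP n c ℏ x) - (fun idx => ((Real.pi * ℏ) ^ (-(1:ℝ)/2) *
      Real.exp (-(etaFun n c x)^2 / ℏ)) * nd.nu idx)) = fun _ _ => 0 := by
        funext ℏ x idx
        simp [deltaP, NormalData.nu, hnrml]
      rw [this]
      refine ⟨Set.univ, Filter.univ_mem, 1, one_pos, fun j => ⟨0, fun ℏ _ x _ => ?_⟩⟩
      have h0 : iteratedFDeriv ℝ j (fun _ : Fin r → ℝ => (0 : (Fin 1 → Fin r) → ℝ)) = 0 :=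
        iteratedFDeriv_zero_fun
      rw [h0]; simp
  · intro j β
    obtain ⟨C, hC, h⟩ := gauss_form_bdd n c (1:ℝ) j
    refine ⟨C * ∫ u : ℝ, |u|^(β 0) * Real.exp (-(1/2) * u^2), fun ℏ hh => ?_⟩
    have h0 := hh.1
    have hpair : ∑ i, toR n i * nd.dual 0 i = 1 := by
      have := nd.dual_pair 0 0
      rw [hnrml] at this
      simpa [dotR, mul_comm] using this
    have hcontr : (fun y => contr (deltaP n c ℏ y) nd.dual) = fun x => ((Real.pi * ℏ) ^ (-(1:ℝ)/2) *
      Real.exp (-(etaFun n c x)^2 / ℏ)) • (1:ℝ) := by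
      funext y
      simp only [contr, deltaP, Finset.univ_unique, Fin.default_eq_zero, Finset.prod_singleton,
        mul_assoc, smul_eq_mul]
      rw [← Finset.mul_sum, ← Finset.mul_sum]
      rw [← hpair]
      congr 2
      exact Fintype.sum_equiv (Equiv.funUnique (Fin 1) (Fin r)) _ _ (fun x => by simp)
    set B := ℏ ^ (-((j:ℝ)+1)/2) with hB
    set F : ℝ → ℝ := fun u => C * B * (|u|^(β 0) * Real.exp (-u^2/(2*ℏ))) with hF
    have hFi : Integrable F := by
      refine Integrable.const_mul ?_ _
      convert int_base (β 0) (b := 1/(2*ℏ)) (by positivity) using 4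
      ring
    have hmp := volume_preserving_funUnique (Fin 1) ℝ
    have heq : (fun t : Fin 1 → ℝ => (∏ i, |t i| ^ (β i)) *
        (C * (B * Real.exp (-(t 0)^2/(2*ℏ))))) = F ∘ (MeasurableEquiv.funUnique (Fin 1) ℝ) := by
      funext t
      simp [hF]; ring
    refine ⟨fun t => C * (B * Real.exp (-(t 0)^2/(2*ℏ))), ?_, ?_, ?_⟩
    · intro x
      rw [hcontr, hleaf]
      exact h ℏ h0 x
    · rw [heq]
      exact hmp.integrable_comp_of_integrable hFi
    · rw [heq]
      have : ∫ t, (F ∘ (MeasurableEquiv.funUnique (Fin 1) ℝ)) t = ∫ u, F u :=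
        hmp.integral_comp' F
      rw [this, hF, integral_const_mul, int_scale _ h0]
      apply le_of_eq
      have he : -(((j : ℝ) + ((1:ℤ) : ℝ) - (∑ i, (β i : ℝ)) - ((1:ℕ) : ℝ)) / 2) =
          -((j:ℝ)+1)/2 + ((β 0 : ℝ)+1)/2 := by
        simp; ring
      rw [he, Real.rpow_add h0, ← hB]
      ring
end
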